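/- Let A be a unital associative algebra over ℂ. The cohomology of the total complex of the cyclic bicomplex 𝓒(A) is canonically isomorphic to the cyclic cohomology of A: H^n(Tot 𝓒(A)) ≅ HC^n(A) for all n ≥ 0. -/

import Mathlib

noncomputable section
namespace NCG

abbrev Cochain (A : Type) (n : ℕ) : Type := (Fin (n + 1) → A) → ℂ

variable {A : Type} [Ring A] [Algebra ℂ A]

def face {n : ℕ} (a : Fin (n + 2) → A) (i : Fin (n + 1)) : Fin (n + 1) → A :=
  fun j => if j < i then a j.castSucc else if j = i then a j.castSucc * a j.succ else a j.succ

def cyclicFace {n : ℕ} (a : Fin (n + 2) → A) : Fin (n + 1) → A :=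
  fun j => if j = 0 then a (Fin.last (n + 1)) * a 0 else a j.castSucc

def bP {n : ℕ} (φ : Cochain A n) : Cochain A (n + 1) :=
  fun a => ∑ i : Fin (n + 1), (-1 : ℂ) ^ (i : ℕ) * φ (face a i)

def bH {n : ℕ} (φ : Cochain A n) : Cochain A (n + 1) :=
  fun a => bP φ a + (-1 : ℂ) ^ (n + 1) * φ (cyclicFace a)

def lam {n : ℕ} (φ : Cochain A n) : Cochain A n :=
  fun a => (-1 : ℂ) ^ n * φ (fun j => a (j - 1))

def opN {n : ℕ} (φ : Cochain A n) : Cochain A n :=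
  fun a => ∑ k ∈ Finset.range (n + 1), (lam^[k] φ) a

def opS {n : ℕ} (φ : Cochain A (n + 1)) : Cochain A n :=
  fun a => (-1 : ℂ) ^ n * φ (Fin.snoc a 1)

def opB0 {n : ℕ} (φ : Cochain A (n + 1)) : Cochain A n :=
  fun a => φ (Fin.cons 1 a) - (-1 : ℂ) ^ (n + 1) * φ (Fin.snoc a 1)

def opB {n : ℕ} (φ : Cochain A (n + 1)) : Cochain A n := opN (opB0 φ)

def IsML {n : ℕ} (φ : Cochain A n) : Prop :=
  ∃ F : MultilinearMap ℂ (fun _ : Fin (n + 1) => A) ℂ, ⇑F = φ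

/-- Horizontal differential of the cyclic bicomplex `𝓒(A)`, out of column `c`:
`1 - λ` from even-numbered columns and `N` from odd-numbered ones. -/
def horiz (c : ℕ) {m : ℕ} (φ : Cochain A m) : Cochain A m :=
  if c % 2 = 0 then φ - lam φ else opN φ

/-- Vertical differential of the cyclic bicomplex `𝓒(A)` in column `c`:
`b` in even-numbered columns and `-b'` in odd-numbered ones. -/
def vert (c : ℕ) {m : ℕ} (φ : Cochain A m) : Cochain A (m + 1) :=
  if c % 2 = 0 then bH φ else -(bP φ)

/-- The total differential of the cyclic bicomplex `𝓒(A)` on an element of total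
degree `n`, written on components indexed by the cochain degree `q` (the
component of degree `q` sits in column `p = n - q`). -/
def cycD (n : ℕ) (x : ∀ q : ℕ, Cochain A q) : ∀ q : ℕ, Cochain A q
  | 0 => horiz n (x 0)
  | q + 1 => vert (n - q) (x q) + horiz (n - (q + 1)) (x (q + 1))

/-- The family concentrated in degree `n` (column `0`). -/
def inclT (n : ℕ) (φ : Cochain A n) : ∀ m : ℕ, Cochain A m :=
  fun m => if h : m = n then cast (by rw [h]) φ else 0

/-- Membership in `Totᴺ 𝓒(A) = ⊕_{p+q=N} C^q(A)`: components of degree `> N` vanish. -/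
def InTotC (N : ℤ) (x : ∀ q : ℕ, Cochain A q) : Prop :=
  ∀ q : ℕ, x q ≠ 0 → (q : ℤ) ≤ N

/-- Every member of the family is a multilinear cochain. -/
def MLFam (x : ∀ m : ℕ, Cochain A m) : Prop := ∀ m : ℕ, IsML (x m)

section LinearOperators

set_option linter.unusedSectionVars false

/-- The `i`-th coface map at the level of tuples, the last one being `cyclicFace`. -/
def contract (A : Type) [Ring A] (n i : ℕ) (a : Fin (n + 2) → A) : Fin (n + 1) → A :=
  if h : i < n + 1 then face a ⟨i, h⟩ else cyclicFace a

theorem contract_apply {n i : ℕ} (a : Fin (n + 2) → A) (j : Fin (n + 1)) :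
    contract A n i a j = if i < n + 1 then
      (if (j : ℕ) < i then a j.castSucc else if (j : ℕ) = i then a j.castSucc * a j.succ
        else a j.succ)
      else if (j : ℕ) = 0 then a (Fin.last (n + 1)) * a 0 else a j.castSucc := by
  unfold contract face cyclicFace
  by_cases h : i < n + 1 <;> simp only [h, dif_pos, dif_neg, not_false_eq_true, if_true, if_false,
    Fin.lt_def, Fin.ext_iff, Fin.val_zero]

/-- The cyclic rotation of tuples. -/
def rotate (A : Type) (n : ℕ) (a : Fin (n + 1) → A) : Fin (n + 1) → A := fun j => a (j - 1)

theorem rotate_iterate (n k : ℕ) (a : Fin (n + 1) → A) :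
    (rotate A n)^[k] a = fun j => a (j - Fin.ofNat (n + 1) k) := by
  induction k with
  | zero => simp
  | succ k ih =>
    rw [Function.iterate_succ_apply', ih]
    funext j
    simp only [rotate, sub_sub]
    congr 2
    ext
    simp [Fin.val_add, add_comm]

theorem rotate_iterate_self (n : ℕ) (a : Fin (n + 1) → A) : (rotate A n)^[n + 1] a = a := by
  rw [rotate_iterate]
  simp

theorem contract_contract {n i j : ℕ} (hij : i ≤ j) (hj : j < n + 2) (a : Fin (n + 3) → A) :
    contract A n i (contract A (n + 1) (j + 1) a) =
      contract A n j (contract A (n + 1) i a) := by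
  funext k
  obtain ⟨k, hk⟩ := k
  have h0 : (0 : Fin (n + 2)) = ⟨0, by omega⟩ := rfl
  have h0' : (0 : Fin (n + 3)) = ⟨0, by omega⟩ := rfl
  have hl : Fin.last (n + 1) = ⟨n + 1, by omega⟩ := rfl
  have hl' : Fin.last (n + 1 + 1) = ⟨n + 2, by omega⟩ := rfl
  simp only [contract_apply, h0, h0', hl, hl', Fin.castSucc_mk, Fin.succ_mk]
  rcases Nat.lt_or_ge j (n + 1) with hj' | hj'
  · rcases lt_trichotomy k i with hk | hk | hk <;>
      rcases lt_trichotomy k j with hkj | hkj | hkj <;>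
      first
      | omega
      | rcases lt_trichotomy (k + 1) j with hkj' | hkj' | hkj' <;>
        first
        | omega
        | simp (disch := omega) only [if_pos, if_neg, mul_assoc]
  · obtain rfl : j = n + 1 := by omega
    rcases Nat.lt_or_ge i (n + 1) with hi | hi
    · rcases Nat.eq_zero_or_pos i with rfl | hi0
      · rcases Nat.eq_zero_or_pos k with rfl | hk0 <;>
          simp (disch := omega) only [if_pos, if_neg, mul_assoc]
      · rcases lt_trichotomy k i with hk | hk | hk <;>
          rcases Nat.eq_zero_or_pos k with hk0 | hk0 <;>
          first
          | omega
          | simp (disch := omega) only [if_pos, if_neg]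
    · obtain rfl : i = n + 1 := by omega
      rcases Nat.eq_zero_or_pos k with rfl | hk0
      · simp [mul_assoc]
      · simp (disch := omega) only [if_pos, if_neg]

theorem rotate_mk_zero {n : ℕ} (a : Fin (n + 1) → A) (h : 0 < n + 1) :
    rotate A n a ⟨0, h⟩ = a ⟨n, by omega⟩ := by
  simp only [rotate]
  congr 1
  ext
  simp

theorem rotate_mk_succ {n k : ℕ} (a : Fin (n + 1) → A) (h : k + 1 < n + 1) :
    rotate A n a ⟨k + 1, h⟩ = a ⟨k, by omega⟩ := by
  simp only [rotate]
  congr 1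
  ext
  simp [Fin.coe_sub_one, Fin.ext_iff]

theorem contract_zero_rotate {n : ℕ} (a : Fin (n + 2) → A) :
    contract A n 0 (rotate A (n + 1) a) = contract A n (n + 1) a := by
  funext k
  obtain ⟨_ | k, hk⟩ := k
  · simp only [contract_apply, Fin.castSucc_mk, Fin.succ_mk, rotate_mk_zero, rotate_mk_succ]
    simp
    rfl
  · simp [contract_apply, rotate_mk_succ]

theorem contract_succ_rotate {n i : ℕ} (hi : i < n + 1) (a : Fin (n + 2) → A) :
    contract A n (i + 1) (rotate A (n + 1) a) = rotate A n (contract A n i a) := by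
  funext k
  obtain ⟨_ | k, hk⟩ := k
  · have h0 : (0 : Fin (n + 2)) = ⟨0, by omega⟩ := rfl
    have hl : Fin.last (n + 1) = ⟨n + 1, by omega⟩ := rfl
    simp only [contract_apply, rotate_mk_zero, Fin.succ_mk, Fin.castSucc_mk, rotate_mk_succ, h0, hl]
    rcases lt_trichotomy n i with h | rfl | h <;>
      first | omega | simp (disch := omega) only [if_pos, if_neg]
  · simp only [contract_apply, rotate_mk_succ, Fin.succ_mk, Fin.castSucc_mk]
    rcases lt_trichotomy k i with h | h | h <;> rcases Nat.lt_or_ge i n with h' | h' <;>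
      first | omega | simp (disch := omega) only [if_pos, if_neg]

/-- The signed coface operator `φ ↦ (-1)^i φ(…, aᵢ aᵢ₊₁, …)`. -/
def coface (A : Type) [Ring A] (n i : ℕ) : Cochain A n →ₗ[ℂ] Cochain A (n + 1) :=
  (-1 : ℂ) ^ i • LinearMap.funLeft ℂ ℂ (contract A n i)

theorem coface_apply (n i : ℕ) (φ : Cochain A n) (a : Fin (n + 2) → A) :
    coface A n i φ a = (-1 : ℂ) ^ i * φ (contract A n i a) := rfl

/-- `λ` as a linear map. -/
def lamL (A : Type) (n : ℕ) : Cochain A n →ₗ[ℂ] Cochain A n :=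
  (-1 : ℂ) ^ n • LinearMap.funLeft ℂ ℂ (rotate A n)

/-- `N` as a linear map. -/
def normL (A : Type) (n : ℕ) : Cochain A n →ₗ[ℂ] Cochain A n :=
  ∑ k ∈ Finset.range (n + 1), lamL A n ^ k

theorem normL_apply (n : ℕ) (φ : Cochain A n) : normL A n φ = opN φ := by
  funext a
  simp only [normL, opN, LinearMap.sum_apply, Finset.sum_apply, Module.End.pow_apply]
  rfl

/-- `b'` as a linear map. -/
def bPL (A : Type) [Ring A] (n : ℕ) : Cochain A n →ₗ[ℂ] Cochain A (n + 1) :=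
  ∑ i ∈ Finset.range (n + 1), coface A n i

theorem bPL_apply (n : ℕ) (φ : Cochain A n) : bPL A n φ = bP φ := by
  funext a
  simp only [bPL, bP, LinearMap.sum_apply, Finset.sum_apply, coface_apply]
  rw [Finset.sum_range]
  refine Finset.sum_congr rfl fun i _ => ?_
  rw [contract, dif_pos i.isLt]

/-- `b` as a linear map. -/
def bHL (A : Type) [Ring A] (n : ℕ) : Cochain A n →ₗ[ℂ] Cochain A (n + 1) :=
  ∑ i ∈ Finset.range (n + 2), coface A n i

theorem bHL_eq (n : ℕ) : bHL A n = bPL A n + coface A n (n + 1) := Finset.sum_range_succ _ _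

theorem bHL_apply (n : ℕ) (φ : Cochain A n) : bHL A n φ = bH φ := by
  rw [bHL_eq, LinearMap.add_apply, bPL_apply]
  funext a
  simp [bH, coface_apply, contract]

theorem sum_sum_eq_zero_of_antisymm {M : Type*} [AddCommGroup M] (G : ℕ → ℕ → M) (m : ℕ)
    (h : ∀ i j, i ≤ j → j < m → G (j + 1) i = -G i j) :
    ∑ j ∈ Finset.range (m + 1), ∑ i ∈ Finset.range m, G j i = 0 := by
  induction m with
  | zero => simp
  | succ m ih =>
    rw [Finset.sum_range_succ, Finset.sum_congr rfl fun j _ => Finset.sum_range_succ (G j) m,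
      Finset.sum_add_distrib, ih fun i j hij hj => h i j hij (by omega), zero_add,
      ← Finset.sum_add_distrib]
    refine Finset.sum_eq_zero fun i hi => ?_
    rw [h i m (by simpa [Nat.lt_succ_iff] using hi) (by omega), add_neg_cancel]

theorem sum_comp_linearMap {M M' M'' : Type*} [AddCommGroup M] [AddCommGroup M']
    [AddCommGroup M''] [Module ℂ M] [Module ℂ M'] [Module ℂ M''] (s : Finset ℕ)
    (f : ℕ → M' →ₗ[ℂ] M'') (g : M →ₗ[ℂ] M') :
    (∑ i ∈ s, f i) ∘ₗ g = ∑ i ∈ s, f i ∘ₗ g := by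
  ext x
  simp [LinearMap.sum_apply]

theorem linearMap_comp_sum {M M' M'' : Type*} [AddCommGroup M] [AddCommGroup M']
    [AddCommGroup M''] [Module ℂ M] [Module ℂ M'] [Module ℂ M''] (s : Finset ℕ)
    (f : M' →ₗ[ℂ] M'') (g : ℕ → M →ₗ[ℂ] M') :
    f ∘ₗ (∑ i ∈ s, g i) = ∑ i ∈ s, f ∘ₗ g i := by
  ext x
  simp [LinearMap.sum_apply]

theorem coface_comp_coface {n i j : ℕ} (hij : i ≤ j) (hj : j < n + 2) :
    coface A (n + 1) (j + 1) ∘ₗ coface A n i = -(coface A (n + 1) i ∘ₗ coface A n j) := by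
  ext φ a
  simp only [LinearMap.comp_apply, LinearMap.neg_apply, Pi.neg_apply, coface_apply,
    contract_contract hij hj]
  ring

theorem bPL_comp_bPL (n : ℕ) : bPL A (n + 1) ∘ₗ bPL A n = 0 := by
  rw [bPL, sum_comp_linearMap]
  simp only [bPL, linearMap_comp_sum]
  exact sum_sum_eq_zero_of_antisymm (fun j i => coface A (n + 1) j ∘ₗ coface A n i) _
    fun i j hij hj => coface_comp_coface hij (by omega)

theorem bHL_comp_bHL (n : ℕ) : bHL A (n + 1) ∘ₗ bHL A n = 0 := by
  rw [bHL, sum_comp_linearMap]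
  simp only [bHL, linearMap_comp_sum]
  exact sum_sum_eq_zero_of_antisymm (fun j i => coface A (n + 1) j ∘ₗ coface A n i) _
    fun i j hij hj => coface_comp_coface hij hj

theorem lamL_comp_coface_zero (n : ℕ) :
    lamL A (n + 1) ∘ₗ coface A n 0 = coface A n (n + 1) := by
  ext φ a
  change (-1 : ℂ) ^ (n + 1) * ((-1 : ℂ) ^ 0 * φ (contract A n 0 (rotate A (n + 1) a))) =
    (-1 : ℂ) ^ (n + 1) * φ (contract A n (n + 1) a)
  rw [contract_zero_rotate, pow_zero, one_mul]

theorem lamL_comp_coface_succ {n i : ℕ} (hi : i < n + 1) :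
    lamL A (n + 1) ∘ₗ coface A n (i + 1) = coface A n i ∘ₗ lamL A n := by
  ext φ a
  change (-1 : ℂ) ^ (n + 1) *
      ((-1 : ℂ) ^ (i + 1) * φ (contract A n (i + 1) (rotate A (n + 1) a))) =
    (-1 : ℂ) ^ i * ((-1 : ℂ) ^ n * φ (rotate A n (contract A n i a)))
  rw [contract_succ_rotate hi]
  ring

theorem lamL_pow_succ (n : ℕ) : lamL A n ^ (n + 1) = 1 := by
  have key : ∀ k : ℕ, lamL A n ^ k =
      ((-1 : ℂ) ^ n) ^ k • LinearMap.funLeft ℂ ℂ (rotate A n)^[k] := by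
    intro k
    induction k with
    | zero => ext; simp
    | succ k ih =>
      rw [pow_succ', ih]
      ext φ a
      simp only [lamL, Module.End.mul_apply, LinearMap.smul_apply, Pi.smul_apply,
        LinearMap.funLeft_apply, smul_eq_mul, Function.iterate_succ_apply]
      ring
  rw [key, ← pow_mul, (Nat.even_mul_succ_self n).neg_one_pow, one_smul]
  ext φ a
  simp only [LinearMap.funLeft_apply, rotate_iterate_self, Module.End.one_apply]

theorem lamL_mul_normL (n : ℕ) : lamL A n * normL A n = normL A n := by
  have h := mul_neg_geom_sum (lamL A n) (n + 1)
  rw [lamL_pow_succ, sub_self, sub_mul, one_mul, sub_eq_zero] at h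
  exact h.symm

theorem normL_mul_lamL (n : ℕ) : normL A n * lamL A n = normL A n := by
  have h := geom_sum_mul_neg (lamL A n) (n + 1)
  rw [lamL_pow_succ, sub_self, mul_sub, mul_one, sub_eq_zero] at h
  exact h.symm

theorem lamL_comp_bHL (n : ℕ) :
    lamL A (n + 1) ∘ₗ bHL A n = coface A n (n + 1) + bPL A n ∘ₗ lamL A n := by
  rw [bHL, Finset.sum_range_succ', LinearMap.comp_add, lamL_comp_coface_zero,
    add_comm (lamL A (n + 1) ∘ₗ _), bPL,
    sum_comp_linearMap, linearMap_comp_sum]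
  congr 1
  exact Finset.sum_congr rfl fun i hi => lamL_comp_coface_succ (Finset.mem_range.mp hi)

theorem one_sub_lamL_comp_bHL (n : ℕ) :
    (1 - lamL A (n + 1)) ∘ₗ bHL A n = bPL A n ∘ₗ (1 - lamL A n) := by
  rw [LinearMap.sub_comp, LinearMap.comp_sub, lamL_comp_bHL, bHL_eq, Module.End.one_eq_id,
    Module.End.one_eq_id, LinearMap.id_comp, LinearMap.comp_id]
  abel

/-- Between two copies of `N`, all signed cofaces agree. -/
theorem normL_comp_coface_comp_normL {n i : ℕ} (hi : i ≤ n + 1) :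
    normL A (n + 1) ∘ₗ coface A n i ∘ₗ normL A n =
      normL A (n + 1) ∘ₗ coface A n 0 ∘ₗ normL A n := by
  induction i with
  | zero => rfl
  | succ i ih =>
    rw [← ih (by omega)]
    conv_lhs => rw [← normL_mul_lamL, Module.End.mul_eq_comp]
    conv_rhs => rw [← lamL_mul_normL n, Module.End.mul_eq_comp]
    rw [LinearMap.comp_assoc, ← LinearMap.comp_assoc _ _ (lamL A (n + 1)),
      lamL_comp_coface_succ (by omega), LinearMap.comp_assoc]

theorem normL_comp_bPL (n : ℕ) :
    normL A (n + 1) ∘ₗ bPL A n = bHL A n ∘ₗ normL A n := by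
  have hP : normL A (n + 1) ∘ₗ bPL A n ∘ₗ normL A n =
      ((n + 1 : ℕ) : ℂ) • (normL A (n + 1) ∘ₗ coface A n 0 ∘ₗ normL A n) := by
    rw [bPL, sum_comp_linearMap, linearMap_comp_sum, Finset.sum_congr rfl fun i hi =>
      normL_comp_coface_comp_normL (le_of_lt (Finset.mem_range.mp hi)), Finset.sum_const,
      Finset.card_range, Nat.cast_smul_eq_nsmul]
  have hH : normL A (n + 1) ∘ₗ bHL A n ∘ₗ normL A n =
      ((n + 2 : ℕ) : ℂ) • (normL A (n + 1) ∘ₗ coface A n 0 ∘ₗ normL A n) := by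
    rw [bHL, sum_comp_linearMap, linearMap_comp_sum, Finset.sum_congr rfl fun i hi =>
      normL_comp_coface_comp_normL (Nat.lt_succ_iff.mp (Finset.mem_range.mp hi)),
      Finset.sum_const, Finset.card_range, Nat.cast_smul_eq_nsmul]
  have hP' : normL A (n + 1) ∘ₗ bPL A n ∘ₗ normL A n =
      ((n + 1 : ℕ) : ℂ) • (normL A (n + 1) ∘ₗ bPL A n) := by
    have h : (normL A (n + 1) ∘ₗ bPL A n) ∘ₗ lamL A n = normL A (n + 1) ∘ₗ bPL A n := by
      have h1 := congrArg (normL A (n + 1) ∘ₗ ·) (one_sub_lamL_comp_bHL (A := A) n)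
      simp only [← LinearMap.comp_assoc] at h1
      rw [← Module.End.mul_eq_comp, mul_sub, mul_one, normL_mul_lamL, sub_self,
        LinearMap.zero_comp, LinearMap.comp_sub, Module.End.one_eq_id, LinearMap.comp_id] at h1
      exact (sub_eq_zero.mp h1.symm).symm
    have hk : ∀ k : ℕ, (normL A (n + 1) ∘ₗ bPL A n) ∘ₗ (lamL A n ^ k) =
        normL A (n + 1) ∘ₗ bPL A n := by
      intro k
      induction k with
      | zero => rfl
      | succ k ih => rw [pow_succ', Module.End.mul_eq_comp, ← LinearMap.comp_assoc, h, ih]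
    rw [← LinearMap.comp_assoc]
    conv_lhs => enter [2]; rw [normL]
    rw [linearMap_comp_sum, Finset.sum_congr rfl fun k _ => hk k,
      Finset.sum_const, Finset.card_range, Nat.cast_smul_eq_nsmul]
  have hH' : normL A (n + 1) ∘ₗ bHL A n ∘ₗ normL A n =
      ((n + 2 : ℕ) : ℂ) • (bHL A n ∘ₗ normL A n) := by
    have h : lamL A (n + 1) ∘ₗ bHL A n ∘ₗ normL A n = bHL A n ∘ₗ normL A n := by
      have h1 := congrArg (· ∘ₗ normL A n) (one_sub_lamL_comp_bHL (A := A) n)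
      simp only [LinearMap.comp_assoc] at h1
      rw [← Module.End.mul_eq_comp (1 - lamL A n), sub_mul, one_mul, lamL_mul_normL, sub_self,
        LinearMap.comp_zero, LinearMap.sub_comp, Module.End.one_eq_id, LinearMap.id_comp] at h1
      exact (sub_eq_zero.mp h1).symm
    have hk : ∀ k : ℕ, (lamL A (n + 1) ^ k) ∘ₗ bHL A n ∘ₗ normL A n =
        bHL A n ∘ₗ normL A n := by
      intro k
      induction k with
      | zero => rfl
      | succ k ih => rw [pow_succ, Module.End.mul_eq_comp, LinearMap.comp_assoc, h, ih]
    conv_lhs => rw [normL]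
    rw [sum_comp_linearMap, Finset.sum_congr rfl fun k _ => hk k,
      Finset.sum_const, Finset.card_range, Nat.cast_smul_eq_nsmul]
  have hn : ∀ m : ℕ, IsUnit ((m + 1 : ℕ) : ℂ) := fun m =>
    IsUnit.mk0 _ (Nat.cast_ne_zero.mpr m.succ_ne_zero)
  rw [(hn n).smul_left_cancel.mp (hP'.symm.trans hP),
    (hn (n + 1)).smul_left_cancel.mp (hH'.symm.trans hH)]

/-- The horizontal differential as a linear map. -/
def horizL (A : Type) (c m : ℕ) : Cochain A m →ₗ[ℂ] Cochain A m :=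
  if c % 2 = 0 then 1 - lamL A m else normL A m

theorem horizL_apply (c m : ℕ) (φ : Cochain A m) : horizL A c m φ = horiz c φ := by
  unfold horizL horiz
  split_ifs
  · rfl
  · exact normL_apply m φ

/-- The vertical differential as a linear map. -/
def vertL (A : Type) [Ring A] (c m : ℕ) : Cochain A m →ₗ[ℂ] Cochain A (m + 1) :=
  if c % 2 = 0 then bHL A m else -bPL A m

theorem vertL_apply (c m : ℕ) (φ : Cochain A m) : vertL A c m φ = vert c φ := by
  unfold vertL vert
  split_ifs
  · exact bHL_apply m φ
  · rw [LinearMap.neg_apply, bPL_apply]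

theorem vertL_vertL (c m : ℕ) (φ : Cochain A m) :
    vertL A c (m + 1) (vertL A c m φ) = 0 := by
  unfold vertL
  split_ifs
  · exact LinearMap.congr_fun (bHL_comp_bHL m) φ
  · have h : bPL A (m + 1) (bPL A m φ) = 0 := LinearMap.congr_fun (bPL_comp_bPL m) φ
    simp [h]

theorem horizL_vertL (c m : ℕ) (φ : Cochain A m) :
    horizL A c (m + 1) (vertL A c m φ) = -vertL A (c + 1) m (horizL A c m φ) := by
  unfold horizL vertL
  rcases Nat.mod_two_eq_zero_or_one c with h | h
  · have h' : (c + 1) % 2 ≠ 0 := by omega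
    rw [if_pos h, if_pos h, if_pos h, if_neg h', LinearMap.neg_apply, neg_neg]
    exact LinearMap.congr_fun (one_sub_lamL_comp_bHL m) φ
  · have h' : (c + 1) % 2 = 0 := by omega
    have h : c % 2 ≠ 0 := by omega
    rw [if_neg h, if_neg h, if_neg h, if_pos h', LinearMap.neg_apply, map_neg]
    exact congrArg Neg.neg (LinearMap.congr_fun (normL_comp_bPL m) φ)

theorem one_sub_mul_sum_nsmul_pow {R : Type*} [Ring R] (x : R) (m : ℕ) :
    (1 - x) * ∑ k ∈ Finset.range m, k • x ^ k =
      ∑ k ∈ Finset.range m, x ^ k - 1 + x ^ m - m • x ^ m := by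
  induction m with
  | zero => simp
  | succ m ih =>
    rw [Finset.sum_range_succ, mul_add, ih, Finset.sum_range_succ, mul_smul_comm, sub_mul,
      one_mul, ← pow_succ', smul_sub, add_smul, one_smul]
    abel

/-- The contracting homotopy of the rows of the cyclic bicomplex, with values in column `c`. -/
def rowHomotopy (A : Type) (c m : ℕ) : Cochain A m →ₗ[ℂ] Cochain A m :=
  ((m + 1 : ℕ) : ℂ)⁻¹ •
    if c % 2 = 0 then -∑ k ∈ Finset.range (m + 1), k • lamL A m ^ k else 1

theorem normL_eq_add_one_sub_lamL_mul (m : ℕ) :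
    normL A m = ((m + 1 : ℕ) : ℂ) • (1 : Module.End ℂ (Cochain A m)) +
      (1 - lamL A m) * ∑ k ∈ Finset.range (m + 1), k • lamL A m ^ k := by
  rw [one_sub_mul_sum_nsmul_pow, lamL_pow_succ, normL, Nat.cast_smul_eq_nsmul]
  abel

theorem normL_eq_add_mul_one_sub_lamL (m : ℕ) :
    normL A m = ((m + 1 : ℕ) : ℂ) • (1 : Module.End ℂ (Cochain A m)) +
      (∑ k ∈ Finset.range (m + 1), k • lamL A m ^ k) * (1 - lamL A m) := by
  have h : Commute (1 - lamL A m) (∑ k ∈ Finset.range (m + 1), k • lamL A m ^ k) := by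
    refine (Commute.one_left _).sub_left (Commute.sum_right _ _ _ fun k _ => ?_)
    exact ((Commute.refl _).pow_right k).smul_right k
  exact (normL_eq_add_one_sub_lamL_mul m).trans (congrArg _ h.eq)

theorem horizL_rowHomotopy_add (c m : ℕ) (φ : Cochain A m) :
    horizL A c m (rowHomotopy A c m φ) + rowHomotopy A (c + 1) m (horizL A (c + 1) m φ) = φ := by
  have hm : ((m + 1 : ℕ) : ℂ) ≠ 0 := Nat.cast_ne_zero.mpr m.succ_ne_zero
  unfold horizL rowHomotopy
  rcases Nat.mod_two_eq_zero_or_one c with h | h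
  · have h' : (c + 1) % 2 ≠ 0 := by omega
    rw [if_pos h, if_pos h, if_neg h', if_neg h', LinearMap.smul_apply, LinearMap.smul_apply,
      map_smul, ← smul_add, inv_smul_eq_iff₀ hm]
    rw [LinearMap.neg_apply, map_neg, normL_eq_add_one_sub_lamL_mul]
    exact (neg_add_eq_iff_eq_add.mpr (add_comm _ _))
  · have h' : (c + 1) % 2 = 0 := by omega
    have h : c % 2 ≠ 0 := by omega
    rw [if_neg h, if_neg h, if_pos h', if_pos h', LinearMap.smul_apply, LinearMap.smul_apply,
      map_smul, ← smul_add, inv_smul_eq_iff₀ hm]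
    rw [LinearMap.neg_apply, normL_eq_add_mul_one_sub_lamL]
    exact add_neg_cancel_right _ _

theorem horizL_rowHomotopy_of_horizL_eq_zero {c m : ℕ} {φ : Cochain A m}
    (h : horizL A (c + 1) m φ = 0) : horizL A c m (rowHomotopy A c m φ) = φ := by
  simpa [h] using horizL_rowHomotopy_add c m φ

end LinearOperators

section Multilinear

set_option linter.unusedSectionVars false

/-- The submodule of multilinear cochains. -/
def multilinearCochains (A : Type) [Ring A] [Algebra ℂ A] (n : ℕ) :
    Submodule ℂ (Cochain A n) where
  carrier := {φ | IsML φ}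
  add_mem' := by
    rintro _ _ ⟨F, rfl⟩ ⟨G, rfl⟩
    exact ⟨F + G, rfl⟩
  zero_mem' := ⟨0, rfl⟩
  smul_mem' := by
    rintro c _ ⟨F, rfl⟩
    exact ⟨c • F, rfl⟩

theorem isML_comp_rotate {n : ℕ} {φ : Cochain A n} (h : IsML φ) :
    IsML (φ ∘ rotate A n) := by
  obtain ⟨F, rfl⟩ := h
  exact ⟨F.domDomCongr (Equiv.subRight 1), rfl⟩

theorem exists_face_update {n : ℕ} (a : Fin (n + 2) → A) (i : Fin (n + 1)) (k : Fin (n + 2)) :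
    ∃ (k' : Fin (n + 1)) (ℓ : A →ₗ[ℂ] A), ∀ x,
      face (Function.update a k x) i = Function.update (face a i) k' (ℓ x) := by
  obtain ⟨i, hi⟩ := i
  obtain ⟨k, hk⟩ := k
  rcases lt_trichotomy k i with h | h | h
  · refine ⟨⟨k, by omega⟩, LinearMap.id, fun x => ?_⟩
    funext ⟨j, hj⟩
    simp only [face, Function.update_apply, Fin.ext_iff, Fin.lt_def, Fin.castSucc_mk, Fin.succ_mk,
      LinearMap.id_apply]
    grind
  · refine ⟨⟨i, hi⟩, LinearMap.mulRight ℂ (a ⟨i + 1, by omega⟩), fun x => ?_⟩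
    funext ⟨j, hj⟩
    simp only [face, Function.update_apply, Fin.ext_iff, Fin.lt_def, Fin.castSucc_mk, Fin.succ_mk,
      LinearMap.mulRight_apply]
    grind
  · rcases Nat.lt_or_ge (i + 1) k with h' | h'
    · refine ⟨⟨k - 1, by omega⟩, LinearMap.id, fun x => ?_⟩
      funext ⟨j, hj⟩
      simp only [face, Function.update_apply, Fin.ext_iff, Fin.lt_def, Fin.castSucc_mk,
        Fin.succ_mk, LinearMap.id_apply]
      grind
    · refine ⟨⟨i, hi⟩, LinearMap.mulLeft ℂ (a ⟨i, by omega⟩), fun x => ?_⟩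
      funext ⟨j, hj⟩
      simp only [face, Function.update_apply, Fin.ext_iff, Fin.lt_def, Fin.castSucc_mk,
        Fin.succ_mk, LinearMap.mulLeft_apply]
      grind

theorem isML_comp_face {n : ℕ} {φ : Cochain A n} (h : IsML φ) (i : Fin (n + 1)) :
    IsML (fun a : Fin (n + 2) → A => φ (face a i)) := by
  obtain ⟨F, rfl⟩ := h
  refine ⟨{ toFun := fun a => F (face a i), map_update_add' := ?_, map_update_smul' := ?_ }, rfl⟩
  · intro inst a k x y
    obtain rfl : inst = instDecidableEqFin _ := Subsingleton.elim _ _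
    obtain ⟨k', ℓ, hℓ⟩ := exists_face_update a i k
    simp only [hℓ, map_add, F.map_update_add]
  · intro inst a k c x
    obtain rfl : inst = instDecidableEqFin _ := Subsingleton.elim _ _
    obtain ⟨k', ℓ, hℓ⟩ := exists_face_update a i k
    simp only [hℓ, map_smul, F.map_update_smul]

theorem isML_lamL {n : ℕ} {φ : Cochain A n} (h : IsML φ) : IsML (lamL A n φ) :=
  (multilinearCochains A n).smul_mem _ (isML_comp_rotate h)

theorem isML_coface {n i : ℕ} (hi : i ≤ n + 1) {φ : Cochain A n} (h : IsML φ) :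
    IsML (coface A n i φ) := by
  have key : ∀ i < n + 1, IsML (coface A n i φ) := fun i hi => by
    refine (multilinearCochains A (n + 1)).smul_mem _ ?_
    change IsML _
    convert isML_comp_face h ⟨i, hi⟩ using 1
    funext a
    simp [LinearMap.funLeft_apply, contract, hi]
  rcases hi.lt_or_eq with hi | rfl
  · exact key i hi
  · rw [← lamL_comp_coface_zero]
    exact isML_lamL (key 0 n.succ_pos)

theorem isML_sum {n : ℕ} {φ : Cochain A n} {m : ℕ} (s : Finset ℕ)
    (f : ℕ → Cochain A n →ₗ[ℂ] Cochain A m) (h : ∀ i ∈ s, IsML (f i φ)) :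
    IsML ((∑ i ∈ s, f i) φ) := by
  rw [LinearMap.sum_apply]
  exact (multilinearCochains A m).sum_mem h

theorem isML_lamL_pow {n : ℕ} {φ : Cochain A n} (h : IsML φ) (k : ℕ) :
    IsML ((lamL A n ^ k) φ) := by
  induction k with
  | zero => exact h
  | succ k ih =>
    rw [pow_succ', Module.End.mul_apply]
    exact isML_lamL ih

theorem isML_vertL {c n : ℕ} {φ : Cochain A n} (h : IsML φ) : IsML (vertL A c n φ) := by
  unfold vertL
  split_ifs
  · exact isML_sum _ _ fun i hi =>
      isML_coface (Nat.lt_succ_iff.mp (Finset.mem_range.mp hi)) h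
  · exact (multilinearCochains A (n + 1)).neg_mem <| isML_sum _ _ fun i hi =>
      isML_coface (Finset.mem_range.mp hi).le h

theorem isML_rowHomotopy {c n : ℕ} {φ : Cochain A n} (h : IsML φ) :
    IsML (rowHomotopy A c n φ) := by
  refine (multilinearCochains A n).smul_mem _ ?_
  split_ifs
  · exact (multilinearCochains A n).neg_mem <| isML_sum _ _ fun k _ =>
      (multilinearCochains A n).smul_of_tower_mem k (isML_lamL_pow h k)
  · exact h

end Multilinear

section TotalComplex

set_option linter.unusedSectionVars false

/-- The contribution of the vertical differential to `cycD`. -/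
def vertPart (n : ℕ) (x : ∀ q : ℕ, Cochain A q) : ∀ q : ℕ, Cochain A q
  | 0 => 0
  | q + 1 => vertL A (n - q) q (x q)

theorem cycD_eq (n : ℕ) (x : ∀ q : ℕ, Cochain A q) (q : ℕ) :
    cycD n x q = vertPart n x q + horizL A (n - q) q (x q) := by
  cases q with
  | zero => simp [cycD, vertPart, horizL_apply]
  | succ q => simp [cycD, vertPart, horizL_apply, vertL_apply]

theorem vertL_vertPart (n : ℕ) (x : ∀ q : ℕ, Cochain A q) (q : ℕ) :
    vertL A (n + 1 - q) q (vertPart n x q) = 0 := by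
  cases q with
  | zero => exact map_zero _
  | succ q =>
    rw [Nat.add_sub_add_right]
    exact vertL_vertL _ _ _

theorem isML_vertPart (n : ℕ) {x : ∀ q : ℕ, Cochain A q} (hx : MLFam x) (q : ℕ) :
    IsML (vertPart n x q) := by
  cases q with
  | zero => exact (multilinearCochains A 0).zero_mem
  | succ q => exact isML_vertL (hx q)

/-- A family of total degree `n` such that `cycD n` recovers a closed `x` below degree `n + 1`,
obtained from the row homotopies by recursion on the cochain degree. -/
def primitive (n : ℕ) (x : ∀ q : ℕ, Cochain A q) : ∀ q : ℕ, Cochain A q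
  | 0 => rowHomotopy A n 0 (x 0)
  | q + 1 =>
    if q + 1 ≤ n then
      rowHomotopy A (n - (q + 1)) (q + 1) (x (q + 1) - vertL A (n - q) q (primitive n x q))
    else 0

theorem primitive_of_le {n q : ℕ} (x : ∀ q : ℕ, Cochain A q) (h : q ≤ n) :
    primitive n x q = rowHomotopy A (n - q) q (x q - vertPart n (primitive n x) q) := by
  cases q with
  | zero => simp [primitive, vertPart]
  | succ q => simp [primitive, vertPart, h]

theorem primitive_of_lt {n q : ℕ} (x : ∀ q : ℕ, Cochain A q) (h : n < q) :
    primitive n x q = 0 := by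
  cases q with
  | zero => omega
  | succ q => rw [primitive, if_neg (by omega)]

theorem mlFam_primitive (n : ℕ) {x : ∀ q : ℕ, Cochain A q} (hx : MLFam x) :
    MLFam (primitive n x) := by
  intro q
  induction q with
  | zero => exact isML_rowHomotopy (hx 0)
  | succ q ih =>
    rw [primitive]
    split_ifs
    · exact isML_rowHomotopy ((multilinearCochains A (q + 1)).sub_mem (hx _) (isML_vertL ih))
    · exact (multilinearCochains A (q + 1)).zero_mem

theorem horizL_sub_vertPart {n : ℕ} {x : ∀ q : ℕ, Cochain A q}
    (hx : ∀ q ≤ n + 1, cycD (n + 1) x q = 0) {q : ℕ} (hq : q ≤ n + 1) :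
    horizL A (n + 1 - q) q (x q - vertPart n (primitive n x) q) = 0 := by
  induction q with
  | zero =>
    have h := hx 0 (Nat.zero_le _)
    rw [cycD_eq] at h
    simpa [vertPart] using h
  | succ q ih =>
    have hq' : q ≤ n := by omega
    have ih' := ih (by omega)
    have hsub : n + 1 - q = n - q + 1 := by omega
    have hy : horizL A (n - q) q (primitive n x q) = x q - vertPart n (primitive n x) q := by
      rw [primitive_of_le x hq']
      exact horizL_rowHomotopy_of_horizL_eq_zero (hsub ▸ ih')
    have h := hx (q + 1) hq
    have hv := vertL_vertPart n (primitive n x) q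
    rw [cycD_eq, Nat.add_sub_add_right, vertPart] at h
    rw [hsub] at h hv
    rw [Nat.add_sub_add_right, vertPart, map_sub, horizL_vertL, hy, map_sub, hv, sub_zero,
      sub_neg_eq_add]
    exact (add_comm _ _).trans h

theorem cycD_primitive {n : ℕ} {x : ∀ q : ℕ, Cochain A q}
    (hx : ∀ q ≤ n + 1, cycD (n + 1) x q = 0) {q : ℕ} (hq : q ≤ n) :
    cycD n (primitive n x) q = x q := by
  have h := horizL_sub_vertPart hx (q := q) (by omega)
  rw [show n + 1 - q = n - q + 1 by omega] at h
  rw [cycD_eq]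
  conv_lhs => rw [primitive_of_le x hq, horizL_rowHomotopy_of_horizL_eq_zero h]
  exact add_sub_cancel _ _

theorem bH_vertPart (n : ℕ) (x : ∀ q : ℕ, Cochain A q) :
    bH (vertPart n x (n + 1)) = 0 := by
  have h := vertL_vertPart n x (n + 1)
  rwa [Nat.sub_self, vertL_apply] at h

/-- Up to the boundary of `y`, a family closed up to degree `n` is concentrated in degree `n`,
and its component there is cyclic. -/
theorem exists_sub_cycD_cyclic (n : ℕ) (x : ∀ q : ℕ, Cochain A q) (hML : MLFam x)
    (hx : ∀ q ≤ n, cycD n x q = 0) :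
    ∃ y : ∀ q : ℕ, Cochain A q, MLFam y ∧ InTotC ((n : ℤ) - 1) y ∧
      (∀ q < n, cycD (n - 1) y q = x q) ∧ IsML (x n - cycD (n - 1) y n) ∧
      lam (x n - cycD (n - 1) y n) = x n - cycD (n - 1) y n ∧
      bH (x n - cycD (n - 1) y n) = bH (x n) := by
  cases n with
  | zero =>
    have h0 : cycD (0 - 1) (0 : ∀ q : ℕ, Cochain A q) 0 = 0 := by
      rw [cycD_eq]
      exact (zero_add _).trans (map_zero _)
    refine ⟨0, fun q => (multilinearCochains A q).zero_mem, fun q hq => absurd rfl hq,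
      fun q hq => absurd hq (Nat.not_lt_zero q), ?_⟩
    rw [h0, sub_zero]
    refine ⟨hML 0, ?_, rfl⟩
    have h := hx 0 le_rfl
    exact (sub_eq_zero.mp h).symm
  | succ n =>
    have hlast : cycD n (primitive n x) (n + 1) = vertPart n (primitive n x) (n + 1) := by
      rw [cycD_eq, primitive_of_lt x n.lt_succ_self, map_zero, add_zero]
    refine ⟨primitive n x, mlFam_primitive n hML, fun q hq => ?_, fun q hq =>
      cycD_primitive hx (Nat.lt_succ_iff.mp hq), ?_⟩
    · by_contra h
      exact hq (primitive_of_lt x (by omega))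
    rw [Nat.add_sub_cancel, hlast]
    refine ⟨(multilinearCochains A (n + 1)).sub_mem (hML _)
      (isML_vertPart n (mlFam_primitive n hML) _), ?_, ?_⟩
    · have h := horizL_sub_vertPart hx (q := n + 1) le_rfl
      rw [Nat.sub_self] at h
      exact (sub_eq_zero.mp h).symm
    · rw [← bHL_apply, map_sub, bHL_apply, bHL_apply, bH_vertPart, sub_zero]

theorem inclT_self (n : ℕ) (φ : Cochain A n) : inclT n φ n = φ := by simp [inclT]

theorem inclT_of_ne {n q : ℕ} (h : q ≠ n) (φ : Cochain A n) : inclT n φ q = 0 := by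
  simp [inclT, h]

theorem InTotC.eq_zero {n q : ℕ} {x : ∀ q : ℕ, Cochain A q} (hx : InTotC (n : ℤ) x)
    (hq : n < q) : x q = 0 := by
  by_contra h
  have := hx q h
  omega

/-- The top component of `cycD n x` for `x` of total degree `n`. -/
theorem cycD_succ_self {n : ℕ} {x : ∀ q : ℕ, Cochain A q} (hx : InTotC (n : ℤ) x) :
    cycD n x (n + 1) = bH (x n) := by
  rw [cycD_eq, hx.eq_zero n.lt_succ_self, map_zero, add_zero, vertPart, Nat.sub_self, vertL_apply]
  rfl

theorem cycD_of_lt {n q : ℕ} {x : ∀ q : ℕ, Cochain A q} (hx : InTotC (n : ℤ) x)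
    (hq : n + 1 < q) : cycD n x q = 0 := by
  cases q with
  | zero => omega
  | succ q =>
    rw [cycD_eq, hx.eq_zero (q := q + 1) (by omega), vertPart, hx.eq_zero (q := q) (by omega),
      map_zero, map_zero, add_zero]

theorem inTotC_inclT (n : ℕ) (φ : Cochain A n) : InTotC (n : ℤ) (inclT n φ) := by
  intro q hq
  by_contra h
  exact hq (inclT_of_ne (by omega) φ)

theorem cycD_inclT {n : ℕ} {φ : Cochain A n} (hφ : lam φ = φ) :
    cycD n (inclT n φ) = inclT (n + 1) (bH φ) := by
  funext q
  rcases lt_trichotomy q (n + 1) with h | rfl | h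
  · have hv : vertPart n (inclT n φ) q = 0 := by
      cases q with
      | zero => rfl
      | succ q => rw [vertPart, inclT_of_ne (by omega), map_zero]
    rw [cycD_eq, hv, zero_add, inclT_of_ne h.ne]
    rcases (Nat.lt_succ_iff.mp h).lt_or_eq with h | rfl
    · rw [inclT_of_ne h.ne, map_zero]
    · rw [inclT_self, Nat.sub_self]
      exact sub_eq_zero.mpr hφ.symm
  · rw [cycD_succ_self (inTotC_inclT n φ), inclT_self, inclT_self]
  · rw [cycD_of_lt (inTotC_inclT n φ) h, inclT_of_ne h.ne']

end TotalComplex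

/-- The cohomology of the total complex of the cyclic bicomplex `𝓒(A)` is
canonically isomorphic to cyclic cohomology, `Hⁿ(Tot 𝓒(A)) ≅ HCⁿ(A)`: the
canonical inclusion of the cyclic complex as column `0` is a chain map (first
conjunct) inducing a bijection on cohomology in every degree `n` (second
conjunct: surjectivity; third and fourth: injectivity in degree `0` and in
degrees `≥ 1`). -/
theorem total_cyclic_bicomplex_cohomology_is_cyclic_cohomology
    (A : Type) [Ring A] [Algebra ℂ A] :
    -- chain map property
    (∀ (n : ℕ) (φ : Cochain A n), IsML φ → lam φ = φ →
      cycD n (inclT n φ) = inclT (n + 1) (bH φ)) ∧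
    -- surjectivity on cohomology in degree n
    (∀ (n : ℕ) (x : ∀ q : ℕ, Cochain A q), MLFam x → InTotC (n : ℤ) x → cycD n x = 0 →
      ∃ (φ : Cochain A n) (y : ∀ q : ℕ, Cochain A q),
        IsML φ ∧ lam φ = φ ∧ bH φ = 0 ∧ MLFam y ∧ InTotC ((n : ℤ) - 1) y ∧
        x = inclT n φ + cycD (n - 1) y) ∧
    -- injectivity on cohomology in degree 0
    (∀ φ : Cochain A 0, IsML φ → lam φ = φ → bH φ = 0 →
      (∃ y : ∀ q : ℕ, Cochain A q, MLFam y ∧ InTotC (-1 : ℤ) y ∧ inclT 0 φ = cycD 0 y) →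
      φ = 0) ∧
    -- injectivity on cohomology in degree n + 1
    (∀ (n : ℕ) (φ : Cochain A (n + 1)), IsML φ → lam φ = φ → bH φ = 0 →
      (∃ y : ∀ q : ℕ, Cochain A q, MLFam y ∧ InTotC (n : ℤ) y ∧ inclT (n + 1) φ = cycD n y) →
      ∃ ψ : Cochain A n, IsML ψ ∧ lam ψ = ψ ∧ bH ψ = φ) := by
  refine ⟨fun n φ _ hφ => cycD_inclT hφ, ?_, ?_, ?_⟩
  · intro n x hML hx hD
    obtain ⟨y, hyML, hy, hlow, hφML, hφ, hb⟩ :=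
      exists_sub_cycD_cyclic n x hML fun q _ => congrFun hD q
    refine ⟨x n - cycD (n - 1) y n, y, hφML, hφ, ?_, hyML, hy, ?_⟩
    · rw [hb, ← cycD_succ_self hx, hD]
      rfl
    · funext q
      rw [Pi.add_apply]
      rcases lt_trichotomy q n with h | rfl | h
      · rw [inclT_of_ne h.ne, zero_add, hlow q h]
      · rw [inclT_self, sub_add_cancel]
      · have hy0 : ∀ r, n ≤ r → y r = 0 := fun r hr => by
          by_contra hne
          have := hy r hne
          omega
        obtain ⟨q, rfl⟩ : ∃ r, q = r + 1 := ⟨q - 1, by omega⟩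
        rw [inclT_of_ne h.ne', hx.eq_zero h, cycD_eq, vertPart, hy0 q (by omega),
          hy0 (q + 1) h.le, map_zero, map_zero, add_zero, add_zero]
  · rintro φ - - - ⟨y, -, hy, h⟩
    have hy0 : y 0 = 0 := by
      by_contra hne
      have := hy 0 hne
      omega
    rw [← inclT_self 0 φ, h, cycD_eq, hy0, map_zero, add_zero]
    rfl
  · rintro n φ - - - ⟨y, hyML, hy, h⟩
    obtain ⟨z, -, -, -, hψML, hψ, hb⟩ := exists_sub_cycD_cyclic n y hyML fun q hq => by
      rw [← h, inclT_of_ne (by omega)]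
    exact ⟨_, hψML, hψ, by rw [hb, ← cycD_succ_self hy, ← h, inclT_self]⟩

end NCG
end
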